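/- Fix a real number p with 0 < p < 1 and n ≥ 1. The function φ on [1,∞)^n defined by φ(u) = Σ_{i=1}^n ((u_i + √(u_i² − 1))^p + (u_i − √(u_i² − 1))^p) is Schur-concave: whenever v, u ∈ [1,∞)^n and v is majorized by u, one has φ(v) ≥ φ(u). -/

import Mathlib

/-- The sum of the `k` largest entries of `x`, expressed as the supremum of the
sums of `x` over all subsets of cardinality `k`. -/
noncomputable def kLargestSum {n : ℕ} (x : Fin n → ℝ) (k : ℕ) : ℝ :=
  sSup {y : ℝ | ∃ s : Finset (Fin n), s.card = k ∧ y = ∑ i ∈ s, x i}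

/-- `v` is majorized by `u`. -/
def IsMajorizedBy {n : ℕ} (v u : Fin n → ℝ) : Prop :=
  (∀ k : ℕ, 1 ≤ k → k ≤ n - 1 → kLargestSum v k ≤ kLargestSum u k) ∧
  ∑ i, v i = ∑ i, u i

/-- The function `φ(u) = Σᵢ ((uᵢ + √(uᵢ² − 1))^p + (uᵢ − √(uᵢ² − 1))^p)`. -/
noncomputable def phi {n : ℕ} (p : ℝ) (u : Fin n → ℝ) : ℝ :=
  ∑ i, ((u i + Real.sqrt ((u i) ^ 2 - 1)) ^ p + (u i - Real.sqrt ((u i) ^ 2 - 1)) ^ p)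

open Real in
theorem Real.sinh_mul_le_mul_sinh {p t : ℝ} (hp0 : 0 ≤ p) (hp1 : p ≤ 1) (ht : 0 ≤ t) :
    sinh (p * t) ≤ p * sinh t := by
  have hd : ∀ x, HasDerivAt (fun x => p * sinh x - sinh (p * x))
      (p * (cosh x - cosh (p * x))) x := fun x => by
    have h := ((hasDerivAt_sinh x).const_mul p).sub ((hasDerivAt_id' x).const_mul p).sinh
    exact h.congr_deriv (by ring)
  have hm : MonotoneOn (fun x => p * sinh x - sinh (p * x)) (Set.Ici 0) := by
    refine monotoneOn_of_deriv_nonneg (convex_Ici 0)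
      (fun x _ => (hd x).continuousAt.continuousWithinAt)
      (fun x _ => (hd x).differentiableAt.differentiableWithinAt) fun x hx => ?_
    rw [interior_Ici, Set.mem_Ioi] at hx
    rw [(hd x).deriv]
    refine mul_nonneg hp0 (sub_nonneg.2 (cosh_le_cosh.2 ?_))
    rw [abs_mul, abs_of_nonneg hp0]
    exact mul_le_of_le_one_left (abs_nonneg x) hp1
  have h := hm Set.self_mem_Ici ht ht
  simp only [mul_zero, sinh_zero, sub_zero] at h
  linarith

open Real in
theorem Real.mul_cosh_mul_sinh_le {p t : ℝ} (hp0 : 0 ≤ p) (hp1 : p ≤ 1) (ht : 0 ≤ t) :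
    p * cosh (p * t) * sinh t ≤ sinh (p * t) * cosh t := by
  have hd : ∀ x, HasDerivAt (fun x => sinh (p * x) * cosh x - p * cosh (p * x) * sinh x)
      ((1 - p ^ 2) * (sinh (p * x) * sinh x)) x := fun x => by
    have hpx := (hasDerivAt_id' x).const_mul p
    have h := (hpx.sinh.mul (hasDerivAt_cosh x)).sub
      ((hpx.cosh.const_mul p).mul (hasDerivAt_sinh x))
    exact h.congr_deriv (by ring)
  have hm : MonotoneOn (fun x => sinh (p * x) * cosh x - p * cosh (p * x) * sinh x)
      (Set.Ici 0) := by
    refine monotoneOn_of_deriv_nonneg (convex_Ici 0)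
      (fun x _ => (hd x).continuousAt.continuousWithinAt)
      (fun x _ => (hd x).differentiableAt.differentiableWithinAt) fun x hx => ?_
    rw [interior_Ici, Set.mem_Ioi] at hx
    rw [(hd x).deriv]
    exact mul_nonneg (by nlinarith) (mul_nonneg (sinh_nonneg_iff.2 (by positivity))
      (sinh_nonneg_iff.2 hx.le))
  have h := hm Set.self_mem_Ici ht ht
  simp only [mul_zero, sinh_zero, zero_mul, sub_zero] at h
  linarith

/-- The derivative of `cosh (p * t)` with respect to `cosh t`, for `0 ≤ t`. -/
noncomputable def coshSlope (p t : ℝ) : ℝ :=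
  if t = 0 then p ^ 2 else p * (Real.sinh (p * t) / Real.sinh t)

open Real in
theorem coshSlope_mul_sinh (p t : ℝ) : coshSlope p t * sinh t = p * sinh (p * t) := by
  unfold coshSlope
  split_ifs with h
  · simp [h]
  · rw [mul_assoc, div_mul_cancel₀ _ (sinh_eq_zero.not.2 h)]

open Real in
theorem coshSlope_antitoneOn {p : ℝ} (hp0 : 0 ≤ p) (hp1 : p ≤ 1) :
    AntitoneOn (coshSlope p) (Set.Ici 0) := by
  have hd : ∀ x, 0 < x → HasDerivAt (fun x => sinh (p * x) / sinh x)
      ((p * cosh (p * x) * sinh x - sinh (p * x) * cosh x) / sinh x ^ 2) x := fun x hx => by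
    have h := ((hasDerivAt_id' x).const_mul p).sinh.div (hasDerivAt_sinh x)
      (sinh_pos_iff.2 hx).ne'
    exact h.congr_deriv (by ring)
  have ha : AntitoneOn (fun x => sinh (p * x) / sinh x) (Set.Ioi 0) := by
    refine antitoneOn_of_deriv_nonpos (convex_Ioi 0)
      (fun x hx => (hd x hx).continuousAt.continuousWithinAt)
      (fun x hx => ?_) fun x hx => ?_ <;> rw [interior_Ioi] at hx
    · exact (hd x hx).differentiableAt.differentiableWithinAt
    · rw [(hd x hx).deriv]
      exact div_nonpos_of_nonpos_of_nonneg
        (sub_nonpos.2 (mul_cosh_mul_sinh_le hp0 hp1 (Set.mem_Ioi.1 hx).le)) (sq_nonneg _)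
  intro a ha0 b hb0 hab
  rw [Set.mem_Ici] at ha0 hb0
  rcases hb0.eq_or_lt with rfl | hb
  · rw [le_antisymm hab ha0]
  rcases ha0.eq_or_lt with rfl | ha'
  · rw [coshSlope, coshSlope, if_neg hb.ne', if_pos rfl, sq]
    exact mul_le_mul_of_nonneg_left
      ((div_le_iff₀ (sinh_pos_iff.2 hb)).2 (sinh_mul_le_mul_sinh hp0 hp1 hb.le)) hp0
  · rw [coshSlope, coshSlope, if_neg hb.ne', if_neg ha'.ne']
    exact mul_le_mul_of_nonneg_left (ha ha' hb hab) hp0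

open Real in
theorem cosh_mul_le_cosh_mul_add {p a t : ℝ} (hp0 : 0 ≤ p) (hp1 : p ≤ 1) (ha : 0 ≤ a)
    (ht : 0 ≤ t) :
    cosh (p * t) ≤ cosh (p * a) + coshSlope p a * (cosh t - cosh a) := by
  have hd : ∀ x, HasDerivAt (fun x => coshSlope p a * cosh x - cosh (p * x))
      ((coshSlope p a - coshSlope p x) * sinh x) x := fun x => by
    have h := ((hasDerivAt_cosh x).const_mul (coshSlope p a)).sub
      ((hasDerivAt_id' x).const_mul p).cosh
    exact h.congr_deriv (by rw [sub_mul, coshSlope_mul_sinh]; ring)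
  suffices h : coshSlope p a * cosh a - cosh (p * a) ≤ coshSlope p a * cosh t - cosh (p * t) by
    linarith
  rcases le_total a t with hat | hta
  · refine monotoneOn_of_deriv_nonneg (convex_Ici a)
      (fun x _ => (hd x).continuousAt.continuousWithinAt)
      (fun x _ => (hd x).differentiableAt.differentiableWithinAt) (fun x hx => ?_)
      Set.self_mem_Ici hat hat
    rw [interior_Ici, Set.mem_Ioi] at hx
    rw [(hd x).deriv]
    exact mul_nonneg (sub_nonneg.2 (coshSlope_antitoneOn hp0 hp1 ha (ha.trans hx.le) hx.le))
      (sinh_nonneg_iff.2 (ha.trans hx.le))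
  · refine antitoneOn_of_deriv_nonpos (convex_Icc 0 a)
      (fun x _ => (hd x).continuousAt.continuousWithinAt)
      (fun x _ => (hd x).differentiableAt.differentiableWithinAt) (fun x hx => ?_)
      ⟨ht, hta⟩ ⟨ha, le_rfl⟩ hta
    rw [interior_Icc] at hx
    rw [(hd x).deriv]
    exact mul_nonpos_of_nonpos_of_nonneg
      (sub_nonpos.2 (coshSlope_antitoneOn hp0 hp1 hx.1.le ha hx.2.le))
      (sinh_nonneg_iff.2 hx.1.le)

open Real in
theorem rpow_add_rpow_eq_two_mul_cosh (p : ℝ) {x : ℝ} (hx : 1 ≤ x) :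
    (x + √(x ^ 2 - 1)) ^ p + (x - √(x ^ 2 - 1)) ^ p = 2 * cosh (p * arcosh x) := by
  have h : x - √(x ^ 2 - 1) = exp (-arcosh x) := by
    rw [← cosh_sub_sinh, cosh_arcosh hx, sinh_arcosh hx]
  rw [h, ← exp_arcosh hx, ← exp_mul, ← exp_mul, cosh_eq]
  ring_nf

/-- Abel summation inequality: a monotone weight bounded by `M` against a sequence with
nonnegative partial sums. -/
theorem Fin.sum_mul_le_of_monotone {n : ℕ} (c d : Fin n → ℝ) (M : ℝ) (hc : Monotone c)
    (hM : ∀ i, c i ≤ M) (hd : ∀ k ≤ n, 0 ≤ ∑ i : Fin n with i.val < k, d i) :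
    ∑ i, c i * d i ≤ M * ∑ i, d i := by
  induction n generalizing M with
  | zero => simp
  | succ n ih =>
    have h := ih (fun i => c i.castSucc) (fun i => d i.castSucc) (c (Fin.last n))
      (fun i j hij => hc (Fin.castSucc_le_castSucc_iff.2 hij))
      (fun i => hc (Fin.le_last _)) fun k hk => by
        have := hd k (hk.trans n.le_succ)
        rw [Finset.sum_filter, Fin.sum_univ_castSucc] at this
        simpa [Finset.sum_filter, hk.not_gt] using this
    have hn : 0 ≤ ∑ i, d i := by
      have := hd (n + 1) le_rfl
      rwa [Finset.filter_true_of_mem fun i _ => i.isLt] at this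
    calc ∑ i, c i * d i ≤ c (Fin.last n) * ∑ i, d i := by
          rw [Fin.sum_univ_castSucc, Fin.sum_univ_castSucc, mul_add]
          linarith
      _ ≤ M * ∑ i, d i := mul_le_mul_of_nonneg_right (hM _) hn

theorem sum_le_kLargestSum {n : ℕ} (x : Fin n → ℝ) (s : Finset (Fin n)) :
    ∑ i ∈ s, x i ≤ kLargestSum x s.card := by
  refine le_csSup (Set.Finite.bddAbove ?_) ⟨s, rfl, rfl⟩
  refine (Set.finite_range fun s : Finset (Fin n) => ∑ i ∈ s, x i).subset ?_
  rintro _ ⟨s, -, rfl⟩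
  exact ⟨s, rfl⟩

theorem Antitone.sum_le_sum_filter_lt {n : ℕ} {x : Fin n → ℝ} (hx : Antitone x)
    (s : Finset (Fin n)) : ∑ i ∈ s, x i ≤ ∑ i : Fin n with i.val < s.card, x i := by
  rcases s.eq_empty_or_nonempty with rfl | hs
  · simp
  have hs0 := hs.card_pos
  have hsn : s.card ≤ n := by simpa using s.card_le_univ
  set c := x ⟨s.card - 1, by omega⟩ with hc
  have hcard : (Finset.univ.filter fun i : Fin n => i.val < s.card).card = s.card := by
    rw [Fin.card_filter_val_lt, min_eq_right hsn]
  have h : ∑ i ∈ s, (x i - c) ≤ ∑ i : Fin n with i.val < s.card, (x i - c) := by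
    rw [← Finset.filter_univ_mem s, Finset.sum_filter, Finset.filter_univ_mem, Finset.sum_filter]
    refine Finset.sum_le_sum fun i _ => ?_
    have h1 : i.val < s.card → c ≤ x i := fun hi => hx (Fin.mk_le_mk.2 (by omega))
    have h2 : ¬ i.val < s.card → x i ≤ c := fun hi => hx (Fin.mk_le_mk.2 (by omega))
    split_ifs with h3 h4 h4
    · rfl
    · linarith [h2 h4]
    · linarith [h1 h4]
    · rfl
  rw [Finset.sum_sub_distrib, Finset.sum_sub_distrib, Finset.sum_const, Finset.sum_const,
    hcard] at h
  linarith

theorem kLargestSum_le_of_antitone_comp {n k : ℕ} (hk : k ≤ n) {x : Fin n → ℝ}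
    (σ : Equiv.Perm (Fin n)) (hx : Antitone (x ∘ σ)) :
    kLargestSum x k ≤ ∑ i : Fin n with i.val < k, x (σ i) := by
  refine csSup_le ?_ ?_
  · obtain ⟨s, -, hs⟩ := Finset.exists_subset_card_eq (s := (Finset.univ : Finset (Fin n)))
      (n := k) (by simpa using hk)
    exact ⟨_, s, hs, rfl⟩
  · rintro _ ⟨s, rfl, rfl⟩
    have h := hx.sum_le_sum_filter_lt (s.map σ.symm.toEmbedding)
    simpa using h

theorem exists_perm_antitone_comp {n : ℕ} (x : Fin n → ℝ) :
    ∃ σ : Equiv.Perm (Fin n), Antitone (x ∘ σ) :=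
  ⟨Tuple.sort (-x), fun _ _ hij => neg_le_neg_iff.1 (Tuple.monotone_sort (-x) hij)⟩

/-- A Karamata inequality for functions admitting an antitone choice of supergradients. -/
theorem IsMajorizedBy.sum_le_sum {n : ℕ} {u v : Fin n → ℝ} (h : IsMajorizedBy v u)
    {s : Set ℝ} {f c : ℝ → ℝ} (hc : AntitoneOn c s)
    (hf : ∀ x ∈ s, ∀ y ∈ s, f y ≤ f x + c x * (y - x))
    (hu : ∀ i, u i ∈ s) (hv : ∀ i, v i ∈ s) :
    ∑ i, f (u i) ≤ ∑ i, f (v i) := by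
  obtain ⟨σ, hσ⟩ := exists_perm_antitone_comp v
  obtain ⟨τ, hτ⟩ := exists_perm_antitone_comp u
  rcases n.eq_zero_or_pos with rfl | hn
  · simp
  have hsum : ∑ i, (u (τ i) - v (σ i)) = 0 := by
    rw [Finset.sum_sub_distrib, Equiv.sum_comp τ u, Equiv.sum_comp σ v, h.2, sub_self]
  have hpartial : ∀ k ≤ n, 0 ≤ ∑ i : Fin n with i.val < k, (u (τ i) - v (σ i)) := by
    intro k hk
    rcases k.eq_zero_or_pos with rfl | hk0
    · simp
    rcases hk.eq_or_lt with rfl | hkn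
    · rw [Finset.filter_true_of_mem fun i _ => i.isLt, hsum]
    have h1 := sum_le_kLargestSum v
      ((Finset.univ.filter fun i : Fin n => i.val < k).map σ.toEmbedding)
    rw [Finset.card_map, Fin.card_filter_val_lt, min_eq_right hk, Finset.sum_map] at h1
    rw [Finset.sum_sub_distrib, sub_nonneg]
    exact h1.trans ((h.1 k hk0 (by omega)).trans (kLargestSum_le_of_antitone_comp hk τ hτ))
  have habel := Fin.sum_mul_le_of_monotone (fun i => c (v (σ i)))
    (fun i => u (τ i) - v (σ i)) (c (v (σ ⟨n - 1, by omega⟩)))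
    (fun i j hij => hc (hv _) (hv _) (hσ hij))
    (fun i => hc (hv _) (hv _) (hσ (Fin.mk_le_mk.2 (by omega)))) hpartial
  rw [hsum, mul_zero] at habel
  calc ∑ i, f (u i) = ∑ i, f (u (τ i)) := (Equiv.sum_comp τ fun i => f (u i)).symm
    _ ≤ ∑ i, (f (v (σ i)) + c (v (σ i)) * (u (τ i) - v (σ i))) :=
      Finset.sum_le_sum fun i _ => hf _ (hv _) _ (hu _)
    _ ≤ ∑ i, f (v (σ i)) := by
      rw [Finset.sum_add_distrib]
      linarith
    _ = ∑ i, f (v i) := Equiv.sum_comp σ fun i => f (v i)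

theorem phi_schur_concave (p : ℝ) (hp0 : 0 < p) (hp1 : p < 1) (n : ℕ) (hn : 1 ≤ n)
    (u v : Fin n → ℝ) (hu : ∀ i, u i ∈ Set.Ici (1 : ℝ)) (hv : ∀ i, v i ∈ Set.Ici (1 : ℝ))
    (hmaj : IsMajorizedBy v u) :
    phi p u ≤ phi p v := by
  have hphi : ∀ w : Fin n → ℝ, (∀ i, w i ∈ Set.Ici (1 : ℝ)) →
      phi p w = 2 * ∑ i, Real.cosh (p * Real.arcosh (w i)) := fun w hw => by
    rw [phi, Finset.mul_sum]
    exact Finset.sum_congr rfl fun i _ => rpow_add_rpow_eq_two_mul_cosh p (hw i)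
  rw [hphi u hu, hphi v hv]
  refine mul_le_mul_of_nonneg_left ?_ zero_le_two
  refine hmaj.sum_le_sum (s := Set.Ici 1) (f := fun x => Real.cosh (p * Real.arcosh x))
    (c := fun x => coshSlope p (Real.arcosh x)) ?_ ?_ hu hv
  · intro x hx y hy hxy
    rw [Set.mem_Ici] at hx hy
    exact coshSlope_antitoneOn hp0.le hp1.le (Real.arcosh_nonneg hx) (Real.arcosh_nonneg hy)
      ((Real.arcosh_le_arcosh (by linarith) (by linarith)).2 hxy)
  · intro x hx y hy
    rw [Set.mem_Ici] at hx hy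
    have h := cosh_mul_le_cosh_mul_add hp0.le hp1.le (Real.arcosh_nonneg hx)
      (Real.arcosh_nonneg hy)
    rwa [Real.cosh_arcosh hx, Real.cosh_arcosh hy] at h
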